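/- Let a, b, c, d be complex numbers. Suppose there exist t ∈ (−π, π], a strictly increasing sequence of positive integers (n_k), and a sequence of complex numbers (λ_k) such that for every k, |λ_k − (2π·n_k + t)²| ≤ 1 and λ_k is an eigenvalue of both H_t(a,b) and H_t(c,d). Then ab = cd. -/

import Mathlib

open Real Complex Set

/-- The Mathieu potential `a·exp(−2πi x) + b·exp(2πi x)`. -/
noncomputable def mathieuPot (a b : ℂ) (x : ℝ) : ℂ :=
  a * Complex.exp (-(2 * Real.pi * Complex.I) * (x : ℂ)) +
    b * Complex.exp (2 * Real.pi * Complex.I * (x : ℂ))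

/-- `λ` is an eigenvalue of the operator `H_t(a,b)`: there is a twice continuously
differentiable function `y`, not identically zero on `[0,1]`, satisfying
`−y'' + (a e^{−2πix} + b e^{2πix}) y = λ y` on `[0,1]` with the `t`-quasiperiodic
boundary conditions. -/
def IsEigenvalueH (a b : ℂ) (t : ℝ) (lam : ℂ) : Prop :=
  ∃ y : ℝ → ℂ, ContDiff ℝ 2 y ∧
    (¬ ∀ x ∈ Set.Icc (0:ℝ) 1, y x = 0) ∧
    (∀ x ∈ Set.Icc (0:ℝ) 1,
      -(deriv (deriv y) x) + mathieuPot a b x * y x = lam * y x) ∧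
    y 1 = Complex.exp (Complex.I * t) * y 0 ∧
    deriv y 1 = Complex.exp (Complex.I * t) * deriv y 0


open Filter Topology

/-- The `k`-th Fourier coefficient of `x ↦ exp(-itx) y(x)` on `[0,1]`. -/
noncomputable def quasiCoeff (t : ℝ) (y : ℝ → ℂ) (k : ℤ) : ℂ :=
  ∫ x in (0 : ℝ)..1, Complex.exp (-(Complex.I * (2 * Real.pi * k + t)) * (x : ℂ)) * y x

theorem exp_neg_quasimomentum (t : ℝ) (k : ℤ) :
    Complex.exp (-(Complex.I * (2 * Real.pi * k + t))) * Complex.exp (Complex.I * t) = 1 := by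
  rw [← Complex.exp_add, Complex.exp_eq_one_iff]
  exact ⟨-k, by push_cast; ring⟩

theorem quasiCoeff_recurrence {a b lam : ℂ} {t : ℝ} {y : ℝ → ℂ} (hy : ContDiff ℝ 2 y)
    (hode : ∀ x ∈ Set.Icc (0 : ℝ) 1,
      -(deriv (deriv y) x) + mathieuPot a b x * y x = lam * y x)
    (h0 : y 1 = Complex.exp (Complex.I * t) * y 0)
    (h1 : deriv y 1 = Complex.exp (Complex.I * t) * deriv y 0) (k : ℤ) :
    ((2 * Real.pi * k + t : ℂ) ^ 2 - lam) * quasiCoeff t y k + a * quasiCoeff t y (k + 1)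
      + b * quasiCoeff t y (k - 1) = 0 := by
  have hy1 : ContDiff ℝ 1 (deriv y) := by
    have : ContDiff ℝ (1 + 1) y := by simpa [one_add_one_eq_two] using hy
    exact (contDiff_succ_iff_deriv.1 this).2.2
  have hc : Continuous y := hy.continuous
  have hc2 : Continuous (deriv (deriv y)) := hy1.continuous_deriv le_rfl
  set nu : ℂ := 2 * Real.pi * k + t with hnu
  have hG : ∀ x ∈ Set.uIcc (0 : ℝ) 1, HasDerivAt
      (fun x : ℝ => Complex.exp (-(Complex.I * nu) * (x : ℂ)) * (deriv y x + Complex.I * nu * y x))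
      (Complex.exp (-(Complex.I * nu) * (x : ℂ)) * (deriv (deriv y) x + nu ^ 2 * y x)) x := by
    intro x _
    have e1 : HasDerivAt (fun x : ℝ => Complex.exp (-(Complex.I * nu) * (x : ℂ)))
        (Complex.exp (-(Complex.I * nu) * (x : ℂ)) * (-(Complex.I * nu) * 1)) x :=
      ((Complex.ofRealCLM.hasDerivAt (x := x)).const_mul (-(Complex.I * nu))).cexp
    have e2 : HasDerivAt y (deriv y x) x := (hy.differentiable (by norm_num) x).hasDerivAt
    have e3 : HasDerivAt (deriv y) (deriv (deriv y) x) x :=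
      (hy1.differentiable (by norm_num) x).hasDerivAt
    refine (e1.fun_mul (e3.fun_add (e2.const_mul (Complex.I * nu)))).congr_deriv ?_
    linear_combination (-(Complex.exp (-(Complex.I * nu) * (x : ℂ)) * nu ^ 2 * y x)) * Complex.I_sq
  have hint := intervalIntegral.integral_eq_sub_of_hasDerivAt hG
    (Continuous.intervalIntegrable (by fun_prop) _ _)
  have hexp := exp_neg_quasimomentum t k
  rw [← hnu] at hexp
  have hzero : Complex.exp (-(Complex.I * nu) * ((1 : ℝ) : ℂ)) *
        (deriv y 1 + Complex.I * nu * y 1)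
      - Complex.exp (-(Complex.I * nu) * ((0 : ℝ) : ℂ)) *
        (deriv y 0 + Complex.I * nu * y 0) = 0 := by
    rw [h0, h1]
    simp only [Complex.ofReal_one, mul_one, Complex.ofReal_zero, mul_zero, Complex.exp_zero]
    linear_combination (deriv y 0 + Complex.I * nu * y 0) * hexp
  rw [hzero] at hint
  unfold quasiCoeff
  rw [← intervalIntegral.integral_const_mul, ← intervalIntegral.integral_const_mul,
    ← intervalIntegral.integral_const_mul, ← intervalIntegral.integral_add
      (Continuous.intervalIntegrable (by fun_prop) _ _)
      (Continuous.intervalIntegrable (by fun_prop) _ _),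
    ← intervalIntegral.integral_add
      (Continuous.intervalIntegrable (by fun_prop) _ _)
      (Continuous.intervalIntegrable (by fun_prop) _ _), ← hint]
  refine intervalIntegral.integral_congr fun x hx => ?_
  rw [Set.uIcc_of_le zero_le_one] at hx
  have hode' := hode x hx
  have ep : Complex.exp (-(Complex.I * (2 * Real.pi * (k + 1 : ℤ) + t)) * (x : ℂ)) =
      Complex.exp (-(Complex.I * nu) * (x : ℂ)) *
        Complex.exp (-(2 * Real.pi * Complex.I) * (x : ℂ)) := by
    rw [← Complex.exp_add, hnu]; congr 1; push_cast; ring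
  have em : Complex.exp (-(Complex.I * (2 * Real.pi * (k - 1 : ℤ) + t)) * (x : ℂ)) =
      Complex.exp (-(Complex.I * nu) * (x : ℂ)) *
        Complex.exp (2 * Real.pi * Complex.I * (x : ℂ)) := by
    rw [← Complex.exp_add, hnu]; congr 1; push_cast; ring
  simp only [ep, em]
  unfold mathieuPot at hode'
  linear_combination (Complex.exp (-(Complex.I * nu) * (x : ℂ))) * hode'

theorem quasiCoeff_norm_le {t : ℝ} {y : ℝ → ℂ} (hy : Continuous y) :
    ∃ B : ℝ, ∀ k, ‖quasiCoeff t y k‖ ≤ B := by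
  obtain ⟨B, hB⟩ := isCompact_Icc.exists_bound_of_continuousOn
    (hy.continuousOn (s := Set.Icc (0 : ℝ) 1))
  refine ⟨B * |1 - 0|, fun k => intervalIntegral.norm_integral_le_of_norm_le_const fun x hx => ?_⟩
  rw [Set.uIoc_of_le zero_le_one] at hx
  have : -(Complex.I * (2 * Real.pi * k + t)) * (x : ℂ)
      = ((-(2 * Real.pi * k + t) * x : ℝ) : ℂ) * Complex.I := by push_cast; ring
  rw [norm_mul, this, Complex.norm_exp_ofReal_mul_I, one_mul]
  exact hB x (Set.Ioc_subset_Icc_self hx)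

theorem exists_quasiCoeff_ne_zero {t : ℝ} {y : ℝ → ℂ} (hy : Continuous y)
    (hne : ¬ ∀ x ∈ Set.Icc (0 : ℝ) 1, y x = 0)
    (h0 : y 1 = Complex.exp (Complex.I * t) * y 0) : ∃ k, quasiCoeff t y k ≠ 0 := by
  by_contra! hall
  apply hne
  have : Fact ((0 : ℝ) < 1) := ⟨one_pos⟩
  set z : ℝ → ℂ := fun x => Complex.exp (-(Complex.I * t) * (x : ℂ)) * y x with hz
  have hzc : Continuous z := by fun_prop
  have hz01 : z 0 = z (0 + 1) := by
    have := exp_neg_quasimomentum t 0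
    simp only [Int.cast_zero, mul_zero, zero_add] at this
    simp only [hz, zero_add, h0, Complex.ofReal_zero, Complex.ofReal_one, mul_zero, mul_one,
      Complex.exp_zero]
    linear_combination (-y 0) * this
  let f : C(AddCircle (1 : ℝ), ℂ) :=
    ⟨AddCircle.liftIco 1 0 z, AddCircle.liftIco_continuous hz01 hzc.continuousOn⟩
  have hcoeff : fourierCoeff f = 0 := by
    funext n
    change fourierCoeff (AddCircle.liftIco 1 0 z) n = 0
    rw [fourierCoeff_liftIco_eq, fourierCoeffOn_eq_integral]
    have : (∫ x in (0 : ℝ)..(0 + 1), (fourier (-n)) (x : AddCircle ((0 : ℝ) + 1 - 0)) • z x)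
        = quasiCoeff t y n := by
      unfold quasiCoeff
      rw [zero_add]
      refine intervalIntegral.integral_congr fun x _ => ?_
      simp only [fourier_coe_apply, hz, smul_eq_mul]
      rw [← mul_assoc, ← Complex.exp_add]
      congr 2
      push_cast
      ring
    rw [this, hall n, smul_zero]
  have hsum : Summable (fourierCoeff f) := by rw [hcoeff]; exact summable_zero
  have hf : ∀ x, f x = 0 := fun x => by
    have := has_pointwise_sum_fourier_series_of_summable hsum x
    simp only [hcoeff, Pi.zero_apply, zero_smul] at this
    exact this.unique hasSum_zero
  have hIco : ∀ x ∈ Set.Ico (0 : ℝ) 1, y x = 0 := fun x hx => by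
    have h := hf (x : AddCircle (1 : ℝ))
    change AddCircle.liftIco 1 0 z x = 0 at h
    rw [AddCircle.liftIco_coe_apply (by simpa using hx)] at h
    exact (mul_eq_zero.1 h).resolve_left (Complex.exp_ne_zero _)
  intro x hx
  rcases hx.2.lt_or_eq with h | rfl
  · exact hIco x ⟨hx.1, h⟩
  · rw [h0, hIco 0 (by simp), mul_zero]

theorem tendsto_norm_sq_sub_cofinite (t : ℝ) (lam : ℂ) :
    Tendsto (fun k : ℤ => ‖(2 * Real.pi * k + t : ℂ) ^ 2 - lam‖) cofinite atTop := by
  have h1 : Tendsto (fun k : ℤ => |2 * Real.pi * (k : ℝ) + t|) cofinite atTop := by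
    rw [Int.cofinite_eq, tendsto_sup]
    constructor
    · refine tendsto_abs_atBot_atTop.comp (tendsto_atBot_add_const_right _ _ ?_)
      exact (tendsto_intCast_atBot_iff.2 tendsto_id).const_mul_atBot (by positivity)
    · refine tendsto_abs_atTop_atTop.comp (tendsto_atTop_add_const_right _ _ ?_)
      exact tendsto_intCast_atTop_atTop.const_mul_atTop (by positivity)
  have h2 := tendsto_atTop_add_const_right cofinite (-‖lam‖)
    ((tendsto_pow_atTop two_ne_zero).comp h1)
  refine tendsto_atTop_mono (fun k => ?_) h2
  have h3 := norm_sub_norm_le ((2 * Real.pi * k + t : ℂ) ^ 2) lam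
  have h4 : ‖(2 * Real.pi * k + t : ℂ) ^ 2‖ = |2 * Real.pi * (k : ℝ) + t| ^ 2 := by
    rw [norm_pow, ← Real.norm_eq_abs, ← Complex.norm_real]
    push_cast
    rfl
  simp only [Function.comp]
  linarith

/-- An eigenvalue has an associated bounded Fourier sequence whose largest entry is `1`. -/
theorem IsEigenvalueH.exists_normalized {a b lam : ℂ} {t : ℝ} (h : IsEigenvalueH a b t lam) :
    ∃ (m : ℤ) (u : ℤ → ℂ), u m = 1 ∧ (∀ k, ‖u k‖ ≤ 1) ∧
      ∀ k : ℤ, ((2 * Real.pi * k + t : ℂ) ^ 2 - lam) * u k + a * u (k + 1) + b * u (k - 1) = 0 := by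
  obtain ⟨y, hy, hne, hode, h0, h1⟩ := h
  obtain ⟨B, hB⟩ := quasiCoeff_norm_le (t := t) hy.continuous
  obtain ⟨k0, hk0⟩ := exists_quasiCoeff_ne_zero hy.continuous hne h0
  have hrec := quasiCoeff_recurrence hy hode h0 h1
  set Y := quasiCoeff t y
  have hpos : 0 < ‖Y k0‖ := norm_pos_iff.2 hk0
  have hev : ∀ᶠ k in cocompact ℤ, ‖Y k‖ ≤ ‖Y k0‖ := by
    rw [cocompact_eq_cofinite]
    filter_upwards [(tendsto_norm_sq_sub_cofinite t lam).eventually_ge_atTop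
      ((‖a‖ * B + ‖b‖ * B) / ‖Y k0‖ + 1)] with k hk
    by_contra! hlt
    have e : ((2 * Real.pi * k + t : ℂ) ^ 2 - lam) * Y k = -(a * Y (k + 1) + b * Y (k - 1)) := by
      linear_combination hrec k
    have e' : ‖(2 * Real.pi * k + t : ℂ) ^ 2 - lam‖ * ‖Y k‖ ≤ ‖a‖ * B + ‖b‖ * B := by
      rw [← norm_mul, e, norm_neg]
      refine (norm_add_le _ _).trans ?_
      rw [norm_mul, norm_mul]
      gcongr <;> exact hB _
    have hB0 : 0 ≤ B := (norm_nonneg _).trans (hB 0)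
    have h3 : ((‖a‖ * B + ‖b‖ * B) / ‖Y k0‖ + 1) * ‖Y k0‖ ≤
        ‖(2 * Real.pi * k + t : ℂ) ^ 2 - lam‖ * ‖Y k‖ := by gcongr
    rw [add_mul, div_mul_cancel₀ _ hpos.ne'] at h3
    linarith
  obtain ⟨m, hm⟩ := (continuous_of_discreteTopology (f := fun k => ‖Y k‖)).exists_forall_ge' k0 hev
  have hm0 : 0 < ‖Y m‖ := hpos.trans_le (hm k0)
  refine ⟨m, fun k => Y k / Y m, div_self (norm_pos_iff.1 hm0), fun k => ?_, fun k => ?_⟩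
  · rw [norm_div]
    exact (div_le_one hm0).2 (hm k)
  · linear_combination (Y m)⁻¹ * hrec k

/-- Second order perturbation theory for a normalized solution of the three-term recurrence
near a large resonant frequency. -/
theorem tendsto_eigenvalue_correction {a b : ℂ} {nu : ℕ → ℝ} {lam : ℕ → ℂ} {u : ℕ → ℤ → ℂ}
    (hnu : Tendsto (fun n => |nu n|) atTop atTop) (hu0 : ∀ n, u n 0 = 1)
    (hu : ∀ n k, ‖u n k‖ ≤ 1)
    (hrec : ∀ n (k : ℤ), ((2 * Real.pi * k + nu n : ℂ) ^ 2 - lam n) * u n k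
      + a * u n (k + 1) + b * u n (k - 1) = 0) :
    Tendsto (fun n => (lam n - (nu n : ℂ) ^ 2) * (nu n : ℂ) ^ 2) atTop (𝓝 (a * b / 2)) := by
  have hpi : (Real.pi : ℂ) ≠ 0 := Complex.ofReal_ne_zero.2 Real.pi_ne_zero
  have hw : Tendsto (fun n => ((nu n : ℂ))⁻¹) atTop (𝓝 0) := by
    rw [tendsto_zero_iff_norm_tendsto_zero]
    exact hnu.inv_tendsto_atTop.congr fun n => by simp
  have hne : ∀ᶠ n in atTop, (nu n : ℂ) ≠ 0 := by
    filter_upwards [hnu.eventually_gt_atTop 0] with n hn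
    exact Complex.ofReal_ne_zero.2 (abs_pos.1 hn)
  set D : ℤ → ℕ → ℂ := fun k n => (2 * Real.pi * k + nu n : ℂ) ^ 2 - lam n with hD
  have hbdd : ∀ f : ℕ → ℂ, (∃ C, ∀ n, ‖f n‖ ≤ C) →
      Tendsto (fun n => ((nu n : ℂ))⁻¹ * f n) atTop (𝓝 0) := fun f ⟨C, hC⟩ =>
    hw.zero_mul_isBoundedUnder_le (isBoundedUnder_of ⟨C, hC⟩)
  have hnb : ∀ n (k : ℤ), ‖a * u n (k + 1) + b * u n (k - 1)‖ ≤ ‖a‖ + ‖b‖ := fun n k => by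
    refine (norm_add_le _ _).trans ?_
    rw [norm_mul, norm_mul]
    exact add_le_add (mul_le_of_le_one_right (norm_nonneg _) (hu _ _))
      (mul_le_of_le_one_right (norm_nonneg _) (hu _ _))
  have hD0 : ∀ n, D 0 n = -(a * u n (0 + 1) + b * u n (0 - 1)) := fun n => by
    have := hrec n 0
    rw [hu0] at this
    linear_combination this
  have hDw : ∀ k : ℤ, Tendsto (fun n => D k n * ((nu n : ℂ))⁻¹) atTop (𝓝 (4 * Real.pi * k)) := by
    intro k
    have h1 := hbdd (fun n => D 0 n) ⟨‖a‖ + ‖b‖, fun n => by rw [hD0, norm_neg]; exact hnb n 0⟩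
    have h2 := (h1.add (tendsto_const_nhds (x := (4 * Real.pi * k : ℂ)))).add
      (hw.const_mul (4 * Real.pi ^ 2 * k ^ 2 : ℂ))
    rw [zero_add, mul_zero, add_zero] at h2
    refine h2.congr' ?_
    filter_upwards [hne] with n hn
    simp only [hD]
    push_cast
    field_simp
    ring
  have hDi : ∀ k : ℤ, k ≠ 0 →
      Tendsto (fun n => (D k n * ((nu n : ℂ))⁻¹)⁻¹) atTop (𝓝 (4 * Real.pi * k)⁻¹) :=
    fun k hk => (hDw k).inv₀ (by simp [hk])
  have hDne : ∀ k : ℤ, k ≠ 0 → ∀ᶠ n in atTop, D k n ≠ 0 := fun k hk => by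
    have h4 : (4 * Real.pi * k : ℂ) ≠ 0 := by simp [hk]
    filter_upwards [(hDw k).eventually_ne h4] with n hn
    exact left_ne_zero_of_mul hn
  have hu_zero : ∀ k : ℤ, k ≠ 0 → Tendsto (fun n => u n k) atTop (𝓝 0) := fun k hk => by
    have h1 := (hDi k hk).mul
      (hbdd (fun n => a * u n (k + 1) + b * u n (k - 1)) ⟨_, fun n => hnb n k⟩).neg
    rw [neg_zero, mul_zero] at h1
    refine h1.congr' ?_
    filter_upwards [hne, hDne k hk] with n hn hd
    have := hrec n k
    change D k n * u n k + _ + _ = 0 at this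
    field_simp
    linear_combination -this
  have hu_nu : ∀ k : ℤ, k ≠ 0 → k + 1 ≠ 0 → k - 1 ≠ 0 →
      Tendsto (fun n => u n k * nu n) atTop (𝓝 0) := fun k hk hk1 hk2 => by
    have h1 := (hDi k hk).mul
      (((hu_zero _ hk1).const_mul a).add ((hu_zero _ hk2).const_mul b)).neg
    rw [mul_zero, mul_zero, add_zero, neg_zero, mul_zero] at h1
    refine h1.congr' ?_
    filter_upwards [hne, hDne k hk] with n hn hd
    have := hrec n k
    change D k n * u n k + _ + _ = 0 at this
    field_simp
    linear_combination -this
  have hD0_zero : Tendsto (fun n => D 0 n) atTop (𝓝 0) := by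
    have := (((hu_zero 1 one_ne_zero).const_mul a).add
      ((hu_zero (-1) (by norm_num)).const_mul b)).neg
    simp only [mul_zero, add_zero, neg_zero] at this
    exact this.congr fun n => by rw [hD0]; norm_num
  have hP := hDi 1 one_ne_zero
  have hM := hDi (-1) (by norm_num)
  have hmain := (((((hD0_zero.const_mul 2).add_const (8 * Real.pi ^ 2 : ℂ)).mul
    (hP.mul hM)).const_mul (a * b)).add (((hu_nu 2 (by norm_num) (by norm_num)
    (by norm_num)).mul hP).const_mul (a ^ 2))).add (((hu_nu (-2) (by norm_num) (by norm_num)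
    (by norm_num)).mul hM).const_mul (b ^ 2))
  have hlim := hmain.neg
  have hval : -(a * b * ((2 * 0 + 8 * (Real.pi : ℂ) ^ 2) *
      ((4 * Real.pi * ((1 : ℤ) : ℂ))⁻¹ * (4 * Real.pi * ((-1 : ℤ) : ℂ))⁻¹))
      + a ^ 2 * (0 * (4 * Real.pi * ((1 : ℤ) : ℂ))⁻¹)
      + b ^ 2 * (0 * (4 * Real.pi * ((-1 : ℤ) : ℂ))⁻¹)) = a * b / 2 := by
    push_cast
    field_simp
    ring
  rw [hval] at hlim
  refine hlim.congr' ?_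
  filter_upwards [hne, hDne 1 one_ne_zero, hDne (-1) (by norm_num)] with n hn hd1 hd2
  have r1 := hrec n 1
  have r2 := hrec n (-1)
  have r0 := hD0 n
  change D 1 n * u n 1 + _ + _ = 0 at r1
  change D (-1) n * u n (-1) + _ + _ = 0 at r2
  norm_num [hu0] at r0 r1 r2
  have hs : 2 * D 0 n + 8 * (Real.pi : ℂ) ^ 2 = D 1 n + D (-1) n := by
    simp only [hD]; push_cast; ring
  have hl : lam n - (nu n : ℂ) ^ 2 = -D 0 n := by
    simp only [hD]; push_cast; ring
  have e1 : u n 1 = -(a * u n 2 + b) / D 1 n := by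
    field_simp; linear_combination r1
  have e2 : u n (-1) = -(a + b * u n (-2)) / D (-1) n := by
    field_simp; linear_combination r2
  rw [hs, hl, r0, e1, e2]
  field_simp
  ring

theorem exists_pos_le_abs_intCast_add (s : ℝ) :
    ∃ δ : ℝ, 0 < δ ∧ ∀ j : ℤ, (j : ℝ) + s ≠ 0 → δ ≤ |(j : ℝ) + s| := by
  have hs := Int.floor_add_fract s
  have hf0 := Int.fract_nonneg s
  have hf1 := Int.fract_lt_one s
  rcases hf0.eq_or_lt with hf | hf
  · refine ⟨1, one_pos, fun j hj => ?_⟩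
    have e : (j : ℝ) + s = ((j + ⌊s⌋ : ℤ) : ℝ) := by push_cast; linarith
    rw [e] at hj ⊢
    exact_mod_cast Int.one_le_abs (by exact_mod_cast hj)
  · refine ⟨min (Int.fract s) (1 - Int.fract s), lt_min hf (by linarith), fun j _ => ?_⟩
    have e : (j : ℝ) + s = ((j + ⌊s⌋ : ℤ) : ℝ) + Int.fract s := by push_cast; linarith
    rw [e]
    rcases le_or_gt 0 (j + ⌊s⌋) with h | h
    · have h' : (0 : ℝ) ≤ ((j + ⌊s⌋ : ℤ) : ℝ) := by exact_mod_cast h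
      exact (min_le_left _ _).trans (le_abs.2 (Or.inl (by linarith)))
    · have h' : ((j + ⌊s⌋ : ℤ) : ℝ) ≤ -1 := by exact_mod_cast (by omega : j + ⌊s⌋ ≤ -1)
      exact (min_le_right _ _).trans (le_abs.2 (Or.inr (by linarith)))

theorem eventually_sq_eq_of_tendsto_sq_sub_sq {t : ℝ} {m m' : ℕ → ℤ}
    (h : Tendsto (fun n => (2 * Real.pi * (m n : ℝ) + t) ^ 2 - (2 * Real.pi * (m' n : ℝ) + t) ^ 2)
      atTop (𝓝 0)) :
    ∀ᶠ n in atTop, (2 * Real.pi * (m n : ℝ) + t) ^ 2 = (2 * Real.pi * (m' n : ℝ) + t) ^ 2 := by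
  obtain ⟨δ, hδ, hsep⟩ := exists_pos_le_abs_intCast_add (t / Real.pi)
  have hpi := Real.pi_pos
  have h4 : 0 < 4 * Real.pi ^ 2 * δ := by positivity
  filter_upwards [h.abs.eventually_lt_const (by simpa using h4)] with n hn
  by_contra hne
  have e : (2 * Real.pi * (m n : ℝ) + t) ^ 2 - (2 * Real.pi * (m' n : ℝ) + t) ^ 2
      = 4 * Real.pi ^ 2 * (((m n - m' n : ℤ) : ℝ) * (((m n + m' n : ℤ) : ℝ) + t / Real.pi)) := by
    push_cast
    field_simp
    ring
  have hprod := sub_ne_zero.2 hne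
  rw [e] at hprod hn
  have h1 := left_ne_zero_of_mul (right_ne_zero_of_mul hprod)
  have h2 := hsep _ (right_ne_zero_of_mul (right_ne_zero_of_mul hprod))
  have h3 : (1 : ℝ) ≤ |((m n - m' n : ℤ) : ℝ)| := by
    exact_mod_cast Int.one_le_abs (by exact_mod_cast h1)
  rw [abs_mul, abs_of_pos (by positivity : 0 < 4 * Real.pi ^ 2), abs_mul] at hn
  have h5 := lt_of_mul_lt_mul_left hn (by positivity)
  have h6 := mul_le_mul h3 h2 hδ.le (abs_nonneg _)
  linarith

/-- Eigenvalues tending to infinity are `ν² + ab/(2ν²) + o(ν⁻²)` for suitable frequencies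
`ν = 2πm + t`. -/
theorem exists_eigenvalue_asymptotics {a b : ℂ} {t : ℝ} {lam : ℕ → ℂ}
    (hlam : Tendsto (fun n => ‖lam n‖) atTop atTop) (h : ∀ n, IsEigenvalueH a b t (lam n)) :
    ∃ m : ℕ → ℤ,
      Tendsto (fun n => lam n - (2 * Real.pi * m n + t : ℂ) ^ 2) atTop (𝓝 0) ∧
      Tendsto (fun n => (lam n - (2 * Real.pi * m n + t : ℂ) ^ 2) *
        (2 * Real.pi * m n + t : ℂ) ^ 2) atTop (𝓝 (a * b / 2)) := by
  choose m u hu1 hu hrec using fun n => (h n).exists_normalized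
  have hcast : ∀ n, ((2 * Real.pi * (m n : ℝ) + t : ℝ) : ℂ) = 2 * Real.pi * m n + t :=
    fun n => by push_cast; rfl
  have hsq : Tendsto (fun n => |2 * Real.pi * (m n : ℝ) + t| ^ 2) atTop atTop := by
    refine tendsto_atTop_mono (fun n => ?_)
      (tendsto_atTop_add_const_right _ (-(‖a‖ + ‖b‖)) hlam)
    have h1 : lam n = ((2 * Real.pi * (m n : ℝ) + t : ℝ) : ℂ) ^ 2
        + (a * u n (m n + 1) + b * u n (m n - 1)) := by
      have := hrec n (m n)
      rw [hu1] at this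
      rw [hcast]
      linear_combination -this
    have h2 : ‖a * u n (m n + 1) + b * u n (m n - 1)‖ ≤ ‖a‖ + ‖b‖ := by
      refine (norm_add_le _ _).trans ?_
      rw [norm_mul, norm_mul]
      exact add_le_add (mul_le_of_le_one_right (norm_nonneg _) (hu _ _))
        (mul_le_of_le_one_right (norm_nonneg _) (hu _ _))
    have h3 := norm_add_le (((2 * Real.pi * (m n : ℝ) + t : ℝ) : ℂ) ^ 2)
      (a * u n (m n + 1) + b * u n (m n - 1))
    rw [← h1, norm_pow, Complex.norm_real, Real.norm_eq_abs] at h3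
    linarith
  have hnu : Tendsto (fun n => |2 * Real.pi * (m n : ℝ) + t|) atTop atTop := by
    simpa [Real.sqrt_sq_eq_abs, Function.comp_def] using Real.tendsto_sqrt_atTop.comp hsq
  have key := tendsto_eigenvalue_correction (a := a) (b := b) (lam := lam)
    (u := fun n j => u n (m n + j)) hnu (fun n => by simpa using hu1 n) (fun n k => hu n _)
    (fun n k => by
      have := hrec n (m n + k)
      rw [add_assoc (m n) k 1, add_sub_assoc (m n) k 1] at this
      rw [hcast]
      push_cast at this
      linear_combination this)
  simp only [hcast] at key
  refine ⟨m, ?_, key⟩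
  have hinv : Tendsto (fun n => ((2 * Real.pi * m n + t : ℂ) ^ 2)⁻¹) atTop (𝓝 0) := by
    rw [tendsto_zero_iff_norm_tendsto_zero]
    refine hsq.inv_tendsto_atTop.congr fun n => ?_
    rw [← hcast, norm_inv, norm_pow, Complex.norm_real, Real.norm_eq_abs]
    rfl
  have hmul := key.mul hinv
  rw [mul_zero] at hmul
  refine hmul.congr' ?_
  filter_upwards [hsq.eventually_gt_atTop 0] with n hn
  have hne : (2 * Real.pi * m n + t : ℂ) ^ 2 ≠ 0 := by
    rw [← hcast]
    exact pow_ne_zero 2 (Complex.ofReal_ne_zero.2 (abs_pos.1 (lt_of_le_of_ne (abs_nonneg _) fun h0 => by simp [← h0] at hn)))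
  exact mul_inv_cancel_right₀ hne _

theorem ab_eq_cd_of_common_eigenvalue_subsequence (a b c d : ℂ)
    (h : ∃ t ∈ Set.Ioc (-Real.pi) Real.pi, ∃ nk : ℕ → ℕ, StrictMono nk ∧
      (∀ k, 0 < nk k) ∧ ∃ lam : ℕ → ℂ, ∀ k : ℕ,
        ‖lam k - (((2 * Real.pi * (nk k) + t : ℝ) : ℂ))^2‖ ≤ 1 ∧
          IsEigenvalueH a b t (lam k) ∧ IsEigenvalueH c d t (lam k)) :
    a * b = c * d := by
  obtain ⟨t, -, nk, hnk, -, lam, hlam⟩ := h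
  have hmu : Tendsto (fun k => 2 * Real.pi * (nk k : ℝ) + t) atTop atTop :=
    tendsto_atTop_add_const_right _ _
      ((tendsto_natCast_atTop_atTop.comp hnk.tendsto_atTop).const_mul_atTop (by positivity))
  have hinf : Tendsto (fun k => ‖lam k‖) atTop atTop := by
    refine tendsto_atTop_mono (fun k => ?_)
      (tendsto_atTop_add_const_right _ (-1) ((tendsto_pow_atTop two_ne_zero).comp hmu))
    have h1 := (hlam k).1
    have h2 := norm_sub_norm_le (((2 * Real.pi * (nk k) + t : ℝ) : ℂ) ^ 2) (lam k)
    rw [norm_sub_rev, norm_pow, Complex.norm_real, Real.norm_eq_abs, sq_abs] at h2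
    simp only [Function.comp]
    linarith
  obtain ⟨m, hm0, hm⟩ := exists_eigenvalue_asymptotics hinf fun k => (hlam k).2.1
  obtain ⟨m', hm0', hm'⟩ := exists_eigenvalue_asymptotics hinf fun k => (hlam k).2.2
  have hdiff : Tendsto (fun n => (2 * Real.pi * (m n : ℝ) + t) ^ 2
      - (2 * Real.pi * (m' n : ℝ) + t) ^ 2) atTop (𝓝 0) := by
    have h1 := (Complex.continuous_re.tendsto _).comp (hm0'.sub hm0)
    rw [sub_zero, Complex.zero_re] at h1
    refine h1.congr fun n => ?_
    rw [Function.comp_apply, ← Complex.ofReal_re ((2 * Real.pi * (m n : ℝ) + t) ^ 2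
      - (2 * Real.pi * (m' n : ℝ) + t) ^ 2)]
    congr 1
    push_cast
    ring
  have heq : (fun n => (lam n - (2 * Real.pi * m n + t : ℂ) ^ 2) *
      (2 * Real.pi * m n + t : ℂ) ^ 2) =ᶠ[atTop]
      fun n => (lam n - (2 * Real.pi * m' n + t : ℂ) ^ 2) * (2 * Real.pi * m' n + t : ℂ) ^ 2 := by
    filter_upwards [eventually_sq_eq_of_tendsto_sq_sub_sq hdiff] with n hn
    have hn' : (2 * Real.pi * m n + t : ℂ) ^ 2 = (2 * Real.pi * m' n + t : ℂ) ^ 2 := by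
      exact_mod_cast congrArg (fun x : ℝ => (x : ℂ)) hn
    rw [hn']
  have := tendsto_nhds_unique (hm.congr' heq) hm'
  linear_combination 2 * this
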